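/- For all nonnegative integers n and k and all real numbers x and y, ĉ_{n,k}(x+y) = Σ_{j=0}^{n} C(n,j) · ĉ_{j,k}(x) · (−1)^{n−j} · (y)_{n−j}, where C(n,j) denotes the binomial coefficient and (y)_m = y(y−1)⋯(y−m+1) is the falling factorial (with (y)_0 = 1). -/

import Mathlib

/-- Unsigned Stirling numbers of the first kind:
`c(0,0)=1`, `c(n,m)=0` for `m>n` or (`n>0` and `m=0`), and `c(n+1,m)=n*c(n,m)+c(n,m-1)`. -/
def stirling1 : ℕ → ℕ → ℕ
  | 0, 0 => 1
  | 0, _ + 1 => 0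
  | _ + 1, 0 => 0
  | n + 1, m + 1 => n * stirling1 n (m + 1) + stirling1 n m

/-- Stirling numbers of the second kind:
`S(0,0)=1`, `S(n,m)=0` for `m>n` or (`n>0` and `m=0`), and `S(n+1,m)=m*S(n,m)+S(n,m-1)`. -/
def stirling2 : ℕ → ℕ → ℕ
  | 0, 0 => 1
  | 0, _ + 1 => 0
  | _ + 1, 0 => 0
  | n + 1, m + 1 => (m + 1) * stirling2 n (m + 1) + stirling2 n m

/-- Poly-Cauchy numbers of the second kind (negated upper index, unsigned):
`ĉ_{n,k} = Σ_{m=0}^n c(n,m)·(m+1)^k`. -/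
def polyCauchy (n k : ℕ) : ℕ := ∑ m ∈ Finset.range (n + 1), stirling1 n m * (m + 1) ^ k

/-- Poly-Cauchy polynomial (of the second kind, negated upper index, unsigned):
`ĉ_{n,k}(z) = Σ_{m=0}^n c(n,m) · Σ_{i=0}^m C(m,i)·(−1)^i·(m−i+1)^k·z^i`. -/
def polyCauchyPoly (n k : ℕ) (z : ℝ) : ℝ :=
  ∑ m ∈ Finset.range (n + 1), (stirling1 n m : ℝ) *
    ∑ i ∈ Finset.range (m + 1),
      (Nat.choose m i : ℝ) * (-1) ^ i * ((m - i + 1 : ℕ) : ℝ) ^ k * z ^ i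

/-- Falling factorial `(z)_m = z(z−1)⋯(z−m+1)` of a real number. -/
def fallFact (z : ℝ) (m : ℕ) : ℝ := ∏ j ∈ Finset.range m, (z - j)

theorem stirling1_eq_zero_of_lt {n m : ℕ} (h : n < m) : stirling1 n m = 0 := by
  induction n generalizing m with
  | zero =>
    obtain ⟨m, rfl⟩ := Nat.exists_eq_succ_of_ne_zero h.ne'
    rfl
  | succ n ih =>
    obtain ⟨m, rfl⟩ := Nat.exists_eq_succ_of_ne_zero (Nat.ne_zero_of_lt h)
    simp [stirling1, ih (show n < m + 1 by omega), ih (show n < m by omega)]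

open Polynomial in
theorem sum_stirling1_mul_pow {R : Type*} [CommRing R] (n : ℕ) (t : R) :
    ∑ m ∈ Finset.range (n + 1), (stirling1 n m : R) * t ^ m = (ascPochhammer R n).eval t := by
  induction n with
  | zero => simp [stirling1]
  | succ n ih =>
    have shift : ∑ m ∈ Finset.range (n + 1), (n : R) * stirling1 n (m + 1) * t ^ (m + 1) =
        n * ∑ m ∈ Finset.range (n + 1), (stirling1 n m : R) * t ^ m := by
      have h := Finset.sum_range_succ' (fun m => (n : R) * stirling1 n m * t ^ m) (n + 1)
      rw [Finset.sum_range_succ, stirling1_eq_zero_of_lt (Nat.lt_succ_self n)] at h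
      have h0 : (n : R) * stirling1 n 0 = 0 := by cases n <;> simp [stirling1]
      simp only [Nat.cast_zero, mul_zero, zero_mul, add_zero, h0] at h
      rw [← h, Finset.mul_sum]
      exact Finset.sum_congr rfl fun _ _ => mul_assoc _ _ _
    rw [ascPochhammer_succ_eval, ← ih, Finset.sum_range_succ']
    simp only [stirling1, Nat.cast_add, Nat.cast_mul, add_mul, Finset.sum_add_distrib, shift,
      Nat.cast_zero, zero_mul, add_zero]
    simp only [pow_succ t, ← mul_assoc, ← Finset.sum_mul]
    ring

theorem ascPochhammer_eval_add {R : Type*} [CommRing R] (n : ℕ) (a b : R) :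
    (ascPochhammer R n).eval (a + b) = ∑ ij ∈ Finset.HasAntidiagonal.antidiagonal n,
      (n.choose ij.1 : R) * ((ascPochhammer R ij.1).eval a * (ascPochhammer R ij.2).eval b) := by
  induction n with
  | zero => simp
  | succ n ih =>
    rw [Finset.sum_antidiagonal_choose_succ_mul
      (fun i j => (ascPochhammer R i).eval a * (ascPochhammer R j).eval b),
      ascPochhammer_succ_eval, ih, Finset.sum_mul, ← Finset.sum_add_distrib]
    refine Finset.sum_congr rfl fun ij hij => ?_
    rw [Finset.HasAntidiagonal.mem_antidiagonal] at hij
    rw [← Nat.choose_symm_of_eq_add hij.symm, ascPochhammer_succ_eval, ascPochhammer_succ_eval,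
      ← hij]
    push_cast
    ring

theorem ascPochhammer_eval_neg_eq_fallFact (m : ℕ) (y : ℝ) :
    (ascPochhammer ℝ m).eval (-y) = (-1) ^ m * fallFact y m := by
  induction m with
  | zero => simp [fallFact]
  | succ m ih =>
    rw [ascPochhammer_succ_eval, ih, fallFact, fallFact, Finset.prod_range_succ]
    ring

/-- The linear functional on real polynomials sending `X ^ j` to `(j + 1) ^ k`. -/
noncomputable def powerMoment (k : ℕ) : Polynomial ℝ →ₗ[ℝ] ℝ :=
  Polynomial.lsum fun j => ((j + 1 : ℕ) : ℝ) ^ k • LinearMap.id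

theorem powerMoment_C_mul_X_pow (k j : ℕ) (a : ℝ) :
    powerMoment k (Polynomial.C a * Polynomial.X ^ j) = ((j + 1 : ℕ) : ℝ) ^ k * a := by
  simp [powerMoment, Polynomial.lsum_apply, Polynomial.C_mul_X_pow_eq_monomial,
    Polynomial.sum_monomial_index]

theorem powerMoment_C_mul (k : ℕ) (a : ℝ) (p : Polynomial ℝ) :
    powerMoment k (Polynomial.C a * p) = a * powerMoment k p := by
  rw [← Polynomial.smul_eq_C_mul, map_smul, smul_eq_mul]

open Polynomial in
theorem powerMoment_X_sub_C_pow (k m : ℕ) (z : ℝ) :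
    powerMoment k ((X - C z) ^ m) = ∑ i ∈ Finset.range (m + 1),
      (Nat.choose m i : ℝ) * (-1) ^ i * ((m - i + 1 : ℕ) : ℝ) ^ k * z ^ i := by
  rw [sub_eq_neg_add, add_pow, map_sum]
  refine Finset.sum_congr rfl fun i _ => ?_
  rw [show (-C z) ^ i * X ^ (m - i) * (m.choose i : ℝ[X]) =
      C ((-z) ^ i * m.choose i) * X ^ (m - i) by simp; ring, powerMoment_C_mul_X_pow, neg_pow]
  ring

open Polynomial in
theorem polyCauchyPoly_eq_powerMoment (n k : ℕ) (z : ℝ) :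
    polyCauchyPoly n k z = powerMoment k ((ascPochhammer ℝ[X] n).eval (X - C z)) := by
  rw [← sum_stirling1_mul_pow, map_sum, polyCauchyPoly]
  refine Finset.sum_congr rfl fun m _ => ?_
  rw [← C_eq_natCast, powerMoment_C_mul, powerMoment_X_sub_C_pow]

open Polynomial in
theorem ascPochhammer_eval_C (m : ℕ) (a : ℝ) :
    (ascPochhammer ℝ[X] m).eval (C a) = C ((ascPochhammer ℝ m).eval a) := by
  rw [← ascPochhammer_map (C : ℝ →+* ℝ[X]), eval_map, eval₂_at_apply]

theorem polyCauchyPoly_add_arg (n k : ℕ) (x y : ℝ) :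
    polyCauchyPoly n k (x + y) = ∑ j ∈ Finset.range (n + 1),
      (Nat.choose n j : ℝ) * polyCauchyPoly j k x * (-1) ^ (n - j) * fallFact y (n - j) := by
  rw [polyCauchyPoly_eq_powerMoment,
    show (Polynomial.X - Polynomial.C (x + y) : Polynomial ℝ) =
      (Polynomial.X - Polynomial.C x) + Polynomial.C (-y) by simp; ring,
    ascPochhammer_eval_add, map_sum, Finset.Nat.sum_antidiagonal_eq_sum_range_succ_mk]
  refine Finset.sum_congr rfl fun j _ => ?_
  rw [ascPochhammer_eval_C, ← Polynomial.C_eq_natCast, powerMoment_C_mul,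
    mul_comm (Polynomial.eval _ _), powerMoment_C_mul, ← polyCauchyPoly_eq_powerMoment, ascPochhammer_eval_neg_eq_fallFact]
  ring
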